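/- For every u ∈ (−1, 0): ∫_{[0,2π)²} log(1 − (u/2)(cos θ₁ + cos θ₂)) dΘ^{(2)}_unif = −(u²/8) ₄F₃(3/2, 3/2, 1, 1; 2, 2, 2; u²) = − Σ_{n=1}^{∞} (B_{2n})² u^{2n}/(2n), where B_{2n} = binomial(2n, n)·(1/2)^{2n}. -/

import Mathlib

open Real MeasureTheory

lemma integral_cos_pow_odd_zero_two_pi (n : ℕ) :
    ∫ x in (0 : ℝ)..(2 * π), cos x ^ (2 * n + 1) = 0 := by
  induction n with
  | zero => simp
  | succ n ih =>
    rw [show 2 * (n + 1) + 1 = (2 * n + 1) + 2 by ring, integral_cos_pow, ih]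
    simp

lemma integral_cos_pow_even_zero_two_pi (n : ℕ) :
    ∫ x in (0 : ℝ)..(2 * π), cos x ^ (2 * n)
      = 2 * π * ((2 * n).factorial / ((n.factorial : ℝ) ^ 2 * 4 ^ n)) := by
  induction n with
  | zero => simp
  | succ n ih =>
    rw [show 2 * (n + 1) = 2 * n + 2 by ring, integral_cos_pow, ih]
    have h := n.factorial_ne_zero
    simp only [Nat.factorial_succ, sin_two_pi, sin_zero, mul_zero, sub_self, zero_div, zero_add]
    push_cast
    field_simp
    ring

lemma sum_range_two_mul_add_one_of_odd_eq_zero {M : Type*} [AddCommMonoid M] (f : ℕ → M)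
    (m : ℕ) (hf : ∀ j < m, f (2 * j + 1) = 0) :
    ∑ i ∈ Finset.range (2 * m + 1), f i = ∑ j ∈ Finset.range (m + 1), f (2 * j) := by
  induction m with
  | zero => simp
  | succ m ih =>
    rw [show 2 * (m + 1) + 1 = 2 * m + 1 + 1 + 1 by ring, Finset.sum_range_succ,
      Finset.sum_range_succ, ih fun j hj => hf j (by omega), hf m (by omega), add_zero,
      Finset.sum_range_succ _ (m + 1)]
    rfl

/-- Lebesgue measure on the square `[0, 2π)²`. -/
noncomputable abbrev squareMeasure : Measure (Fin 2 → ℝ) :=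
  Measure.pi fun _ => volume.restrict (Set.Ico (0 : ℝ) (2 * π))

lemma integrable_squareMeasure_of_continuous_of_bound {f : (Fin 2 → ℝ) → ℝ} (hf : Continuous f)
    (C : ℝ) (hC : ∀ θ, ‖f θ‖ ≤ C) : Integrable f squareMeasure :=
  .of_bound hf.aestronglyMeasurable C (.of_forall hC)

lemma integral_cos_pow_mul_cos_pow (i j : ℕ) :
    ∫ θ, cos (θ 0) ^ i * cos (θ 1) ^ j ∂squareMeasure
      = (∫ x in (0 : ℝ)..(2 * π), cos x ^ i) * ∫ x in (0 : ℝ)..(2 * π), cos x ^ j := by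
  have h := integral_fintype_prod_eq_prod (𝕜 := ℝ) (ι := Fin 2) (E := fun _ => ℝ)
    (μ := fun _ => volume.restrict (Set.Ico (0 : ℝ) (2 * π)))
    (fun k x => cos x ^ (![i, j] k))
  simp only [Fin.prod_univ_two, Matrix.cons_val_zero, Matrix.cons_val_one] at h
  rw [h]
  simp only [intervalIntegral.integral_of_le two_pi_pos.le, integral_Ico_eq_integral_Ioc]

lemma integral_cos_add_cos_pow (k : ℕ) :
    ∫ θ, (cos (θ 0) + cos (θ 1)) ^ k ∂squareMeasure
      = ∑ i ∈ Finset.range (k + 1), (∫ x in (0 : ℝ)..(2 * π), cos x ^ i) *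
        (∫ x in (0 : ℝ)..(2 * π), cos x ^ (k - i)) * k.choose i := by
  simp only [add_pow]
  rw [integral_finsetSum]
  · simp only [integral_mul_const, integral_cos_pow_mul_cos_pow]
  · intro i _
    refine (integrable_squareMeasure_of_continuous_of_bound (by fun_prop) 1 fun θ => ?_).mul_const _
    rw [norm_mul, norm_pow, norm_pow]
    exact mul_le_one₀ (pow_le_one₀ (norm_nonneg _) (abs_cos_le_one _)) (by positivity)
      (pow_le_one₀ (norm_nonneg _) (abs_cos_le_one _))

lemma integral_cos_add_cos_pow_odd (m : ℕ) :
    ∫ θ, (cos (θ 0) + cos (θ 1)) ^ (2 * m + 1) ∂squareMeasure = 0 := by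
  rw [integral_cos_add_cos_pow]
  refine Finset.sum_eq_zero fun i hi => ?_
  rw [Finset.mem_range] at hi
  rcases Nat.even_or_odd' i with ⟨j, rfl | rfl⟩
  · rw [show 2 * m + 1 - 2 * j = 2 * (m - j) + 1 by omega, integral_cos_pow_odd_zero_two_pi]
    simp
  · rw [integral_cos_pow_odd_zero_two_pi]
    simp

lemma integral_cos_add_cos_pow_even (m : ℕ) :
    ∫ θ, (cos (θ 0) + cos (θ 1)) ^ (2 * m) ∂squareMeasure
      = (2 * π) ^ 2 * (((2 * m).choose m : ℝ) ^ 2 / 4 ^ m) := by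
  rw [integral_cos_add_cos_pow, sum_range_two_mul_add_one_of_odd_eq_zero _ m fun j _ => by
    rw [integral_cos_pow_odd_zero_two_pi]; simp]
  have hterm : ∀ j ∈ Finset.range (m + 1),
      (∫ x in (0 : ℝ)..(2 * π), cos x ^ (2 * j)) *
        (∫ x in (0 : ℝ)..(2 * π), cos x ^ (2 * m - 2 * j)) * (2 * m).choose (2 * j)
      = (2 * π) ^ 2 * ((2 * m).choose m / 4 ^ m) * (m.choose j : ℝ) ^ 2 := by
    intro j hj
    obtain ⟨l, rfl⟩ := Nat.exists_eq_add_of_le (Nat.lt_succ_iff.mp (Finset.mem_range.mp hj))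
    rw [show 2 * (j + l) - 2 * j = 2 * l by omega, integral_cos_pow_even_zero_two_pi,
      integral_cos_pow_even_zero_two_pi, Nat.cast_choose ℝ (show 2 * j ≤ 2 * (j + l) by omega),
      Nat.cast_choose ℝ (show j + l ≤ 2 * (j + l) by omega),
      Nat.cast_choose ℝ (show j ≤ j + l by omega),
      show 2 * (j + l) - 2 * j = 2 * l by omega, show j + l - j = l by omega,
      show 2 * (j + l) - (j + l) = j + l by omega]
    have h1 := (2 * j).factorial_ne_zero
    have h2 := (2 * l).factorial_ne_zero
    have h3 := (j + l).factorial_ne_zero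
    have h4 := j.factorial_ne_zero
    have h5 := l.factorial_ne_zero
    field_simp
    exact pow_add 4 j l
  rw [Finset.sum_congr rfl hterm, ← Finset.mul_sum]
  have hsq : ∑ j ∈ Finset.range (m + 1), (m.choose j : ℝ) ^ 2 = (2 * m).choose m := by
    exact_mod_cast Nat.sum_range_choose_sq m
  rw [hsq]
  ring

lemma hasSum_integral_log_one_sub_cos_add_cos {u : ℝ} (hu : |u| < 1) :
    HasSum (fun m : ℕ => (2 * π) ^ 2 *
        ((((2 * (m + 1)).choose (m + 1) : ℝ) * (1 / 2) ^ (2 * (m + 1))) ^ 2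
          * u ^ (2 * (m + 1)) / (2 * (m + 1))))
      (-∫ θ, log (1 - u / 2 * (cos (θ 0) + cos (θ 1))) ∂squareMeasure) := by
  have hz : ∀ θ : Fin 2 → ℝ, |u / 2 * (cos (θ 0) + cos (θ 1))| ≤ |u| := fun θ => by
    have h := abs_add_le (cos (θ 0)) (cos (θ 1))
    rw [abs_mul, abs_div, abs_two]
    nlinarith [abs_nonneg u, abs_cos_le_one (θ 0), abs_cos_le_one (θ 1)]
  have hbound : ∀ (n : ℕ) (θ : Fin 2 → ℝ),
      ‖(u / 2 * (cos (θ 0) + cos (θ 1))) ^ (n + 1) / ((n : ℝ) + 1)‖ ≤ |u| ^ n := fun n θ => by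
    rw [norm_div, norm_pow, Real.norm_eq_abs, Real.norm_of_nonneg (by positivity)]
    refine (div_le_self (by positivity) (by linarith [n.cast_nonneg (α := ℝ)])).trans ?_
    exact (pow_le_pow_left₀ (abs_nonneg _) (hz θ) _).trans
      (pow_le_pow_of_le_one (abs_nonneg u) hu.le n.le_succ)
  have hsum : HasSum
      (fun n : ℕ => ∫ θ, (u / 2 * (cos (θ 0) + cos (θ 1))) ^ (n + 1) / ((n : ℝ) + 1) ∂squareMeasure)
      (∫ θ, -log (1 - u / 2 * (cos (θ 0) + cos (θ 1))) ∂squareMeasure) := by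
    refine hasSum_integral_of_dominated_convergence (fun n _ => |u| ^ n)
      (fun n => Continuous.aestronglyMeasurable (by fun_prop)) (fun n => .of_forall (hbound n))
      (.of_forall fun θ => summable_geometric_of_lt_one (abs_nonneg u) hu)
      (integrable_const _) (.of_forall fun θ => ?_)
    exact hasSum_pow_div_log_of_abs_lt_one ((hz θ).trans_lt hu)
  rw [integral_neg] at hsum
  have hinj : Function.Injective fun m : ℕ => 2 * m + 1 := fun a b h => by
    simp only at h
    omega
  rw [← hinj.hasSum_iff] at hsum
  · convert hsum using 1
    ext m
    simp only [Function.comp_apply, mul_pow (u / 2), integral_div, integral_const_mul]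
    rw [show 2 * m + 1 + 1 = 2 * (m + 1) by ring, integral_cos_add_cos_pow_even, div_pow, div_pow,
      one_pow, show (4 : ℝ) ^ (m + 1) = 2 ^ (2 * (m + 1)) by rw [pow_mul]; norm_num]
    push_cast
    field_simp
    ring
  · intro n hn
    obtain ⟨j, rfl | rfl⟩ := Nat.even_or_odd' n
    · simp only [mul_pow, integral_div, integral_const_mul, integral_cos_add_cos_pow_odd]
      simp
    · exact absurd ⟨j, rfl⟩ hn

lemma choose_mul_half_pow_sq_div_eq_ascPochhammer (n : ℕ) :
    (((2 * (n + 1)).choose (n + 1) : ℝ) * (1 / 2) ^ (2 * (n + 1))) ^ 2 / (2 * (n + 1))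
      = 1 / 8 * (((ascPochhammer ℝ n).eval ((3 : ℝ) / 2)) ^ 2 * (n.factorial : ℝ)
            / ((n + 1).factorial : ℝ) ^ 3) := by
  have h : ((2 * (n + 1)).choose (n + 1) : ℝ) * (1 / 2) ^ (2 * (n + 1))
      = 1 / 2 * (ascPochhammer ℝ n).eval ((3 : ℝ) / 2) / (n + 1).factorial := by
    induction n with
    | zero => norm_num
    | succ n ih =>
      have hc : ((n : ℝ) + 1 + 1) * ((2 * (n + 1 + 1)).choose (n + 1 + 1))
          = 2 * (2 * ((n : ℝ) + 1) + 1) * (2 * (n + 1)).choose (n + 1) := by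
        exact_mod_cast Nat.succ_mul_centralBinom_succ (n + 1)
      have hf := (n + 1).factorial_ne_zero
      rw [ascPochhammer_succ_eval, Nat.factorial_succ (n + 1)]
      rw [eq_div_iff (by positivity)] at ih ⊢
      push_cast at ih ⊢
      rw [show 2 * (n + 1 + 1) = 2 * (n + 1) + 2 by ring, pow_add]
      rw [show 2 * (n + 1 + 1) = 2 * (n + 1) + 2 by ring] at hc
      linear_combination (1 / 2 : ℝ) ^ (2 * (n + 1)) * (n + 1).factorial * (1 / 4) * hc
        + (3 / 2 + (n : ℝ)) * ih
  rw [h, Nat.factorial_succ]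
  have hf := n.factorial_ne_zero
  push_cast
  field_simp
  ring

theorem stmt_16 (u : ℝ) (hu : u ∈ Set.Ioo (-1 : ℝ) 0) :
    (1 / (2 * π) ^ 2) * (∫ θ : Fin 2 → ℝ in Set.univ.pi fun _ => Set.Ico (0:ℝ) (2 * π),
        Real.log (1 - (u / 2) * (Real.cos (θ 0) + Real.cos (θ 1))))
      = -(u ^ 2 / 8) * ∑' n : ℕ,
          ((ascPochhammer ℝ n).eval ((3:ℝ) / 2)) ^ 2 * (n.factorial : ℝ)
            / ((n + 1).factorial : ℝ) ^ 3 * (u ^ 2) ^ n ∧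
    (1 / (2 * π) ^ 2) * (∫ θ : Fin 2 → ℝ in Set.univ.pi fun _ => Set.Ico (0:ℝ) (2 * π),
        Real.log (1 - (u / 2) * (Real.cos (θ 0) + Real.cos (θ 1))))
      = -∑' n : ℕ, (((2 * (n + 1)).choose (n + 1) : ℝ) * ((1:ℝ) / 2) ^ (2 * (n + 1))) ^ 2
          * u ^ (2 * (n + 1)) / (2 * (n + 1)) := by
  have hu' : |u| < 1 := abs_lt.mpr ⟨hu.1, hu.2.trans one_pos⟩
  have hlog : (1 / (2 * π) ^ 2) *
      (∫ θ : Fin 2 → ℝ in Set.univ.pi fun _ => Set.Ico (0:ℝ) (2 * π),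
        Real.log (1 - (u / 2) * (Real.cos (θ 0) + Real.cos (θ 1))))
      = -∑' n : ℕ, (((2 * (n + 1)).choose (n + 1) : ℝ) * ((1:ℝ) / 2) ^ (2 * (n + 1))) ^ 2
          * u ^ (2 * (n + 1)) / (2 * (n + 1)) := by
    have h := (hasSum_integral_log_one_sub_cos_add_cos hu').tsum_eq
    rw [tsum_mul_left] at h
    rw [volume_pi, Measure.restrict_pi_pi, ← neg_eq_iff_eq_neg.mpr h]
    field_simp
  refine ⟨hlog.trans ?_, hlog⟩
  rw [neg_mul, ← tsum_mul_left]
  congr 2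
  ext n
  rw [mul_div_right_comm, choose_mul_half_pow_sq_div_eq_ascPochhammer]
  ring
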